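/- Let F¹ be the class of 1-Lipschitz functions bounded by B on the Euclidean ball B_2^{d+1}(√2 log n), and let μ̂_n be the empirical measure of n i.i.d. samples from a probability measure boldμ supported on this ball. Then E[d_{F¹}(μ̂_n, boldμ)] ≤ C₀ √d · n^{−1/(d+1)} (log n)^{1+1/(d+1)} for a constant C₀ not depending on d or n. -/

import Mathlib

open MeasureTheory

namespace EmpRate

noncomputable def chi {D N : ℕ} [NeZero N] (k a : Fin D → ZMod N) : ℂ :=
  ∏ j, ZMod.stdAddChar (k j * a j)

variable {D N : ℕ} [NeZero N]

lemma chi_add (k a b : Fin D → ZMod N) : chi k (a + b) = chi k a * chi k b := by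
  simp [chi, mul_add, AddChar.map_add_eq_mul, Finset.prod_mul_distrib]

lemma chi_zero_right (k : Fin D → ZMod N) : chi k 0 = 1 := by simp [chi]

lemma chi_zero_left (k : Fin D → ZMod N) : chi 0 k = 1 := by simp [chi]

lemma chi_norm (k a : Fin D → ZMod N) : ‖chi k a‖ = 1 := by
  rw [chi, norm_prod]
  exact Finset.prod_eq_one fun j _ => by rw [ZMod.stdAddChar_apply]; exact Circle.norm_coe _

lemma chi_conj (k a : Fin D → ZMod N) : (starRingEnd ℂ) (chi k a) = chi k (-a) := by
  have h1 : chi k a * chi k (-a) = 1 := by rw [← chi_add]; simp [chi_zero_right]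
  have h2 : chi k a * (starRingEnd ℂ) (chi k a) = 1 := by
    rw [Complex.mul_conj, Complex.normSq_eq_norm_sq, chi_norm]; simp
  have h0 : chi k a ≠ 0 := by
    intro h; rw [h] at h1; simp at h1
  exact mul_left_cancel₀ h0 (h2.trans h1.symm)

lemma chi_sum (a : Fin D → ZMod N) :
    ∑ k : Fin D → ZMod N, chi k a = if a = 0 then (N : ℂ) ^ D else 0 := by
  have h := Finset.prod_univ_sum (fun _ : Fin D => (Finset.univ : Finset (ZMod N)))
    (fun j x => (ZMod.stdAddChar (x * a j) : ℂ))
  rw [Fintype.piFinset_univ] at h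
  unfold chi
  rw [← h]
  simp_rw [AddChar.sum_mulShift _ (ZMod.isPrimitive_stdAddChar N)]
  split_ifs with ha
  · simp [ha]
  · obtain ⟨j, hj⟩ := Function.ne_iff.mp ha
    apply Finset.prod_eq_zero (Finset.mem_univ j)
    rw [if_neg (by simpa using hj)]; simp

noncomputable def hat (Φ : (Fin D → ZMod N) → ℂ) (k : Fin D → ZMod N) : ℂ :=
  ∑ a, Φ a * chi k (-a)

lemma inversion (Φ : (Fin D → ZMod N) → ℂ) (b : Fin D → ZMod N) :
    ∑ k, hat Φ k * chi k b = (N : ℂ) ^ D * Φ b := by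
  unfold hat
  simp_rw [Finset.sum_mul]
  rw [Finset.sum_comm]
  simp_rw [mul_assoc, ← chi_add, ← Finset.mul_sum, chi_sum]
  rw [Finset.sum_eq_single b]
  · simp [mul_comm]
  · intro a _ hab
    rw [if_neg]; simp
    intro h; apply hab; exact (neg_add_eq_zero.mp h)
  · simp

lemma parseval (Φ : (Fin D → ZMod N) → ℂ) :
    ∑ k, ‖hat Φ k‖ ^ 2 = (N : ℝ) ^ D * ∑ a, ‖Φ a‖ ^ 2 := by
  have : ((∑ k, ‖hat Φ k‖ ^ 2 : ℝ) : ℂ) = (((N : ℝ) ^ D * ∑ a, ‖Φ a‖ ^ 2 : ℝ) : ℂ) := by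
    push_cast
    have h1 : ∀ k, ((‖hat Φ k‖ : ℂ)) ^ 2 = ∑ b, (starRingEnd ℂ) (Φ b) * (hat Φ k * chi k b) := by
      intro k
      rw [← Complex.mul_conj']
      conv_lhs => rw [hat.eq_1 Φ k, map_sum]
      rw [← hat.eq_1, Finset.mul_sum]
      refine Finset.sum_congr rfl fun b _ => ?_
      rw [map_mul, chi_conj, neg_neg]; ring
    simp_rw [h1]
    rw [Finset.sum_comm]
    simp_rw [← Finset.mul_sum, inversion, Finset.mul_sum, ← Complex.mul_conj']
    refine Finset.sum_congr rfl fun b _ => ?_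
    ring
  exact_mod_cast this

lemma hat_shift (Φ : (Fin D → ZMod N) → ℂ) (e k : Fin D → ZMod N) :
    hat (fun a => Φ (a + e) - Φ a) k = (chi k e - 1) * hat Φ k := by
  unfold hat
  simp_rw [sub_mul, Finset.sum_sub_distrib, one_mul]
  congr 1
  rw [← Equiv.sum_comp (Equiv.addRight e) (fun a => Φ a * chi k (-a)), Finset.mul_sum]
  refine Finset.sum_congr rfl fun a _ => ?_
  simp only [Equiv.coe_addRight]
  rw [show -a = e + -(a + e) by abel, chi_add]
  ring_nf

noncomputable def lam (k : Fin D → ZMod N) : ℝ :=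
  ∑ j, ‖chi k (Pi.single j 1) - 1‖ ^ 2

lemma chi_single (k : Fin D → ZMod N) (j : Fin D) :
    chi k (Pi.single j 1) = ZMod.stdAddChar (k j) := by
  unfold chi
  rw [Finset.prod_eq_single j]
  · simp
  · intro i _ hij; simp [hij]
  · simp

lemma lam_nonneg (k : Fin D → ZMod N) : 0 ≤ lam k := by unfold lam; positivity

lemma energy (Φ : (Fin D → ZMod N) → ℂ) (h : ℝ) 
    (hΦ : ∀ a j, ‖Φ (a + Pi.single j 1) - Φ a‖ ≤ h) :
    ∑ k, lam k * ‖hat Φ k‖ ^ 2 ≤ (N : ℝ) ^ D * ((N : ℝ) ^ D * (D * h ^ 2)) := by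
  unfold lam
  simp_rw [Finset.sum_mul, ← mul_pow, ← norm_mul, ← hat_shift]
  rw [Finset.sum_comm]
  simp_rw [parseval]
  calc _ ≤ ∑ j : Fin D, (N : ℝ) ^ D * ∑ a : Fin D → ZMod N, h ^ 2 := by
        gcongr with j _ a _; exact hΦ a j
    _ = _ := by simp [ZMod.card]; ring

lemma lam_lower (k : Fin D → ZMod N) :
    16 / (N : ℝ) ^ 2 * ∑ j, ((k j).valMinAbs.natAbs : ℝ) ^ 2 ≤ lam k := by
  unfold lam
  rw [Finset.mul_sum]
  gcongr with j _
  rw [chi_single]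
  set z : ℤ := (k j).valMinAbs with hz
  have hk : k j = (z : ZMod N) := by simp [hz]
  have hN : (0 : ℝ) < N := by exact_mod_cast Nat.pos_of_ne_zero (NeZero.ne N)
  have hzN : 2 * (z.natAbs : ℝ) ≤ N := by
    have := ZMod.natAbs_valMinAbs_le (k j)
    rw [← hz] at this
    have h2 : 2 * z.natAbs ≤ N := by omega
    exact_mod_cast h2
  rw [hk, ZMod.stdAddChar_coe]
  have e1 : Complex.exp (2 * Real.pi * Complex.I * z / N) =
      Complex.exp (Complex.I * ((2 * Real.pi * z / N : ℝ) : ℂ)) := by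
    congr 1; push_cast; ring
  rw [e1, Complex.norm_exp_I_mul_ofReal_sub_one]
  have hsin : 2 * (z.natAbs : ℝ) / N ≤ |Real.sin (2 * Real.pi * z / N / 2)| := by
    have h1 : |Real.sin (2 * Real.pi * z / N / 2)| = |Real.sin (Real.pi * z.natAbs / N)| := by
      rcases Int.natAbs_eq z with h | h
      · conv_lhs => rw [h]
        rw [Int.cast_natCast]; congr 2; ring
      · conv_lhs => rw [h]
        rw [Int.cast_neg, Int.cast_natCast]
        rw [← abs_neg (Real.sin _), ← Real.sin_neg]
        congr 2; ring
    rw [h1]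
    refine le_trans ?_ (le_abs_self _)
    refine le_trans (le_of_eq ?_) (Real.mul_le_sin (by positivity) ?_)
    · field_simp
    · rw [div_le_div_iff₀ hN two_pos]
      nlinarith [Real.pi_pos]
  rw [Real.norm_eq_abs, abs_mul, abs_two, mul_pow]
  calc _ = 4 * (2 * (z.natAbs : ℝ) / N) ^ 2 := by field_simp; ring
    _ ≤ 4 * |Real.sin (2 * Real.pi * z / N / 2)| ^ 2 := by gcongr
    _ = _ := by ring

lemma lam_pos (k : Fin D → ZMod N) (hk : k ≠ 0) : 0 < lam k := by
  refine lt_of_lt_of_le ?_ (lam_lower k)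
  have hN : (0 : ℝ) < N := by exact_mod_cast Nat.pos_of_ne_zero (NeZero.ne N)
  obtain ⟨j, hj⟩ := Function.ne_iff.mp hk
  have : 0 < ∑ j, ((k j).valMinAbs.natAbs : ℝ) ^ 2 := by
    apply Finset.sum_pos' (fun _ _ => by positivity)
    refine ⟨j, Finset.mem_univ _, ?_⟩
    have : (k j).valMinAbs.natAbs ≠ 0 := by simpa using hj
    positivity
  positivity

lemma key (Φ : (Fin D → ZMod N) → ℂ) (h : ℝ) (hh : 0 < h) (hD : 0 < D)
    (hΦ : ∀ a j, ‖Φ (a + Pi.single j 1) - Φ a‖ ≤ h) (Z : (Fin D → ZMod N) → ℂ) (hZ : Z 0 = 0) :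
    ‖∑ k, hat Φ k * Z k‖ ≤ (N : ℝ) ^ D * (√D * h / 2 * (1 + ∑ k, ‖Z k‖ ^ 2 * (lam k)⁻¹)) := by
  have hN : (0 : ℝ) < N := by exact_mod_cast Nat.pos_of_ne_zero (NeZero.ne N)
  have hs : 0 < √(D : ℝ) * h := by positivity
  have hs2 : (√(D : ℝ) * h) ^ 2 = D * h ^ 2 := by
    rw [mul_pow, Real.sq_sqrt (by positivity)]
  set s := √(D : ℝ) * h with hsdef
  set A : ℝ := (N : ℝ) ^ D * s with hA
  have hApos : 0 < A := by positivity
  have hE := energy Φ h hΦ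
  rw [← hs2] at hE
  have hterm : ∀ k, ‖hat Φ k * Z k‖ ≤ 
      1 / (2 * A) * (lam k * ‖hat Φ k‖ ^ 2) + A / 2 * (‖Z k‖ ^ 2 * (lam k)⁻¹) := by
    intro k
    by_cases hk : k = 0
    · subst hk; simp only [hZ, mul_zero, norm_zero]
      have := lam_nonneg (0 : Fin D → ZMod N)
      positivity
    have hl := lam_pos k hk
    rw [norm_mul]
    have h2 : 1 / (2 * A) * (lam k * ‖hat Φ k‖ ^ 2) + A / 2 * (‖Z k‖ ^ 2 * (lam k)⁻¹) - 
      ‖hat Φ k‖ * ‖Z k‖ = 1 / (2 * A * lam k) * (lam k * ‖hat Φ k‖ - A * ‖Z k‖) ^ 2 := by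
      field_simp; ring
    have h3 : 0 ≤ 1 / (2 * A * lam k) * (lam k * ‖hat Φ k‖ - A * ‖Z k‖) ^ 2 := by positivity
    linarith
  calc _ ≤ ∑ k, ‖hat Φ k * Z k‖ := norm_sum_le _ _
    _ ≤ ∑ k, (1 / (2 * A) * (lam k * ‖hat Φ k‖ ^ 2) + A / 2 * (‖Z k‖ ^ 2 * (lam k)⁻¹)) :=
      Finset.sum_le_sum fun k _ => hterm k
    _ = 1 / (2 * A) * ∑ k, (lam k * ‖hat Φ k‖ ^ 2) + A / 2 * ∑ k, (‖Z k‖ ^ 2 * (lam k)⁻¹) := by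
      rw [Finset.sum_add_distrib, Finset.mul_sum, Finset.mul_sum]
    _ ≤ 1 / (2 * A) * ((N : ℝ) ^ D * ((N : ℝ) ^ D * s ^ 2)) + 
        A / 2 * ∑ k, (‖Z k‖ ^ 2 * (lam k)⁻¹) := by gcongr
    _ = _ := by rw [hA]; field_simp

lemma fold_sum (w : ℕ → ℝ) (hw : ∀ x, 0 ≤ w x) :
    ∑ a : ZMod N, w (a.valMinAbs.natAbs) ≤ 2 * ∑ x ∈ Finset.range N, w x := by
  have hN : 0 < N := Nat.pos_of_ne_zero (NeZero.ne N)
  have hmaps : ∀ a ∈ (Finset.univ : Finset (ZMod N)), a.valMinAbs.natAbs ∈ Finset.range N := by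
    intro a _
    have := ZMod.natAbs_valMinAbs_le a
    simp only [Finset.mem_range]; omega
  rw [← Finset.sum_fiberwise_of_maps_to hmaps, Finset.mul_sum]
  refine Finset.sum_le_sum fun x _ => ?_
  rw [Finset.sum_congr rfl (g := fun _ => w x) (by
    intro a ha; rw [(Finset.mem_filter.mp ha).2])]
  rw [Finset.sum_const, nsmul_eq_mul]
  apply mul_le_mul_of_nonneg_right _ (hw x)
  have : (Finset.univ.filter fun a : ZMod N => a.valMinAbs.natAbs = x) ⊆ {(x : ZMod N), -(x : ZMod N)} := by
    intro a ha
    have h := (Finset.mem_filter.mp ha).2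
    have hc := ZMod.coe_valMinAbs a
    simp only [Finset.mem_insert, Finset.mem_singleton]
    rcases Int.natAbs_eq a.valMinAbs with h1 | h1
    · left; rw [← hc, h1, h]; simp
    · right; rw [← hc, h1, h]; simp
  exact_mod_cast (Finset.card_le_card this).trans Finset.card_le_two

lemma tele (x : ℕ) (hx : 1 ≤ x) (n : ℕ) :
    ∑ y ∈ Finset.range n, (((x : ℝ) + y) ^ 2)⁻¹ ≤ 2 / x := by
  have hx' : (1 : ℝ) ≤ x := by exact_mod_cast hx
  suffices h : ∑ y ∈ Finset.range n, (((x : ℝ) + y) ^ 2)⁻¹ ≤ 2 / x - 2 / (x + n) by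
    refine h.trans ?_
    have : 0 ≤ 2 / ((x : ℝ) + n) := by positivity
    linarith
  induction n with
  | zero => simp
  | succ n ih =>
    rw [Finset.sum_range_succ]
    have hu : (1 : ℝ) ≤ x + n := by
      have : (0 : ℝ) ≤ n := by positivity
      linarith
    push_cast
    rw [← add_assoc]
    generalize (x : ℝ) + n = u at *
    have h1 : (u ^ 2)⁻¹ ≤ 2 / u - 2 / (u + 1) := by
      have : 2 / u - 2 / (u + 1) - (u ^ 2)⁻¹ = (u - 1) / (u ^ 2 * (u + 1)) := by
        have : u ≠ 0 := by linarith
        have : u + 1 ≠ 0 := by linarith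
        field_simp; ring
      have h2 : 0 ≤ (u - 1) / (u ^ 2 * (u + 1)) := by
        apply div_nonneg <;> [linarith; positivity]
      linarith
    linarith

lemma grid_sum (hN : 0 < N) : ∑ x ∈ Finset.range N, ∑ y ∈ Finset.range N, ((x : ℝ) ^ 2 + (y : ℝ) ^ 2)⁻¹
    ≤ 6 + 4 * Real.log N := by
  obtain ⟨M, rfl⟩ := Nat.exists_eq_add_of_le' hN
  rw [Finset.sum_range_succ']
  have h0 : ∑ y ∈ Finset.range (M + 1), (((0 : ℕ) : ℝ) ^ 2 + (y : ℝ) ^ 2)⁻¹ ≤ 2 := by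
    rw [Finset.sum_range_succ']
    have := tele 1 le_rfl M
    simp only [Nat.cast_one, div_one] at this
    simp only [Nat.cast_zero, ne_eq, OfNat.ofNat_ne_zero, not_false_eq_true, zero_pow, zero_add,
      Nat.cast_add, Nat.cast_one, inv_zero, add_zero]
    simpa only [add_comm] using this
  have h1 : ∀ x ∈ Finset.range M, ∑ y ∈ Finset.range (M + 1), (((x + 1 : ℕ) : ℝ) ^ 2 + (y : ℝ) ^ 2)⁻¹
      ≤ 4 * ((x + 1 : ℕ) : ℝ)⁻¹ := by
    intro x _
    have := tele (x + 1) (by omega) (M + 1)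
    calc _ ≤ ∑ y ∈ Finset.range (M + 1), 2 * ((((x + 1 : ℕ) : ℝ) + y) ^ 2)⁻¹ := by
          refine Finset.sum_le_sum fun y _ => ?_
          have hx : (0 : ℝ) < ((x + 1 : ℕ) : ℝ) := by positivity
          generalize ((x + 1 : ℕ) : ℝ) = u at *
          have hy : (0 : ℝ) ≤ y := by positivity
          rw [show (2 : ℝ) * ((u + y) ^ 2)⁻¹ = (((u + y) ^ 2) / 2)⁻¹ by field_simp]
          apply inv_anti₀ (by positivity)
          nlinarith [sq_nonneg (u - y)]
      _ = 2 * ∑ y ∈ Finset.range (M + 1), ((((x + 1 : ℕ) : ℝ) + y) ^ 2)⁻¹ := by rw [Finset.mul_sum]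
      _ ≤ 2 * (2 / ((x + 1 : ℕ) : ℝ)) := by gcongr
      _ = _ := by ring
  have h2 := Finset.sum_le_sum h1
  rw [← Finset.mul_sum] at h2
  have h3 := harmonic_le_one_add_log M
  unfold harmonic at h3
  have h4 : ∑ x ∈ Finset.range M, ((x + 1 : ℕ) : ℝ)⁻¹ ≤ 1 + Real.log M := by
    refine le_trans (le_of_eq ?_) h3
    push_cast; rfl
  have h5 : Real.log M ≤ Real.log ((M + 1 : ℕ) : ℝ) := by
    rcases Nat.eq_zero_or_pos M with rfl | hM
    · simp
    · apply Real.log_le_log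
      · exact_mod_cast hM
      · push_cast; linarith
  linarith

lemma zsum : ∑ a : ZMod N, ∑ b : ZMod N,
    ((a.valMinAbs.natAbs : ℝ) ^ 2 + (b.valMinAbs.natAbs : ℝ) ^ 2)⁻¹ ≤ 24 + 16 * Real.log N := by
  have hN : 0 < N := Nat.pos_of_ne_zero (NeZero.ne N)
  calc _ ≤ ∑ a : ZMod N, 2 * ∑ y ∈ Finset.range N, ((a.valMinAbs.natAbs : ℝ) ^ 2 + (y : ℝ) ^ 2)⁻¹ := by
        refine Finset.sum_le_sum fun a _ => ?_
        exact fold_sum (fun y => ((a.valMinAbs.natAbs : ℝ) ^ 2 + (y : ℝ) ^ 2)⁻¹) (fun _ => by positivity)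
    _ ≤ 2 * ∑ x ∈ Finset.range N, 2 * ∑ y ∈ Finset.range N, ((x : ℝ) ^ 2 + (y : ℝ) ^ 2)⁻¹ :=
        fold_sum (fun x => 2 * ∑ y ∈ Finset.range N, ((x : ℝ) ^ 2 + (y : ℝ) ^ 2)⁻¹)
          (fun _ => by positivity)
    _ ≤ _ := by
        rw [← Finset.mul_sum]
        have := grid_sum hN
        linarith

lemma lam_inv_le {d : ℕ} (k : Fin (d + 2) → ZMod N) :
    (lam k)⁻¹ ≤ (N : ℝ) ^ 2 / 16 * ((((k 0).valMinAbs.natAbs : ℝ) ^ 2 + ((k 1).valMinAbs.natAbs : ℝ) ^ 2)⁻¹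
      + (if k 0 = 0 then 1 else 0) * (if k 1 = 0 then 1 else 0)) := by
  have hN : (0 : ℝ) < N := by exact_mod_cast Nat.pos_of_ne_zero (NeZero.ne N)
  by_cases hk : k = 0
  · have : lam k = 0 := by subst hk; simp [lam, chi_zero_left]
    rw [this, inv_zero]; positivity
  have hl := lam_lower k
  have hS : ∀ c : ℝ, 0 < c → c ≤ ∑ j, ((k j).valMinAbs.natAbs : ℝ) ^ 2 →
      (lam k)⁻¹ ≤ (N : ℝ) ^ 2 / 16 * c⁻¹ := by
    intro c hc hcs
    rw [show (N : ℝ) ^ 2 / 16 * c⁻¹ = (16 / (N : ℝ) ^ 2 * c)⁻¹ by field_simp]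
    apply inv_anti₀ (by positivity)
    refine le_trans ?_ hl
    gcongr
  by_cases h01 : k 0 = 0 ∧ k 1 = 0
  · simp only [h01.1, h01.2, if_true, ZMod.valMinAbs_zero]
    have := hS 1 one_pos ?_
    · simpa using this
    · obtain ⟨j, hj⟩ := Function.ne_iff.mp hk
      have h1 : 1 ≤ (k j).valMinAbs.natAbs := by
        have : (k j).valMinAbs.natAbs ≠ 0 := by simpa using hj
        omega
      have h2 : (1 : ℝ) ≤ ((k j).valMinAbs.natAbs : ℝ) ^ 2 := by
        exact_mod_cast Nat.one_le_pow _ _ h1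
      exact h2.trans (Finset.single_le_sum (f := fun j => ((k j).valMinAbs.natAbs : ℝ) ^ 2)
        (fun _ _ => by positivity) (Finset.mem_univ j))
  · refine (hS (((k 0).valMinAbs.natAbs : ℝ) ^ 2 + ((k 1).valMinAbs.natAbs : ℝ) ^ 2) ?_ ?_).trans ?_
    · rw [not_and_or] at h01
      rcases h01 with h | h
      · have : (k 0).valMinAbs.natAbs ≠ 0 := by simpa using h
        positivity
      · have : (k 1).valMinAbs.natAbs ≠ 0 := by simpa using h
        positivity
    · rw [Fin.sum_univ_succ, Fin.sum_univ_succ]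
      have : 0 ≤ ∑ i : Fin d, ((k i.succ.succ).valMinAbs.natAbs : ℝ) ^ 2 := by positivity
      simp only [Fin.succ_zero_eq_one]
      linarith
    · gcongr
      have : (0 : ℝ) ≤ (if k 0 = 0 then 1 else 0) * (if k 1 = 0 then 1 else 0) := by positivity
      linarith

lemma sum_two {d : ℕ} (w : ZMod N → ZMod N → ℝ) :
    ∑ k : Fin (d + 2) → ZMod N, w (k 0) (k 1) = (N : ℝ) ^ d * ∑ a, ∑ b, w a b := by
  rw [← (Fin.consEquiv (fun _ : Fin (d + 2) => ZMod N)).sum_comp, Fintype.sum_prod_type]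
  rw [Finset.mul_sum]
  refine Finset.sum_congr rfl fun a _ => ?_
  rw [← (Fin.consEquiv (fun _ : Fin (d + 1) => ZMod N)).sum_comp, Fintype.sum_prod_type,
    Finset.mul_sum]
  refine Finset.sum_congr rfl fun b _ => ?_
  simp [Fin.consEquiv, ZMod.card]

lemma lam_sum {d : ℕ} : ∑ k : Fin (d + 2) → ZMod N, (lam k)⁻¹ ≤ (N : ℝ) ^ (d + 2) * (2 + Real.log N) := by
  refine (Finset.sum_le_sum fun k _ => lam_inv_le k).trans ?_
  rw [← Finset.mul_sum, sum_two (fun a b => (((a).valMinAbs.natAbs : ℝ) ^ 2 +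
    ((b).valMinAbs.natAbs : ℝ) ^ 2)⁻¹ + (if a = 0 then 1 else 0) * (if b = 0 then 1 else 0))]
  have h : ∑ a : ZMod N, ∑ b : ZMod N, ((((a).valMinAbs.natAbs : ℝ) ^ 2 +
    ((b).valMinAbs.natAbs : ℝ) ^ 2)⁻¹ + (if a = 0 then 1 else 0) * (if b = 0 then 1 else 0))
    ≤ 25 + 16 * Real.log N := by
    simp_rw [Finset.sum_add_distrib]
    have := zsum (N := N)
    have h2 : ∑ a : ZMod N, ∑ b : ZMod N, ((if a = 0 then 1 else 0) * (if b = 0 then 1 else 0) : ℝ) = 1 := by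
      simp
    linarith
  calc _ ≤ (N : ℝ) ^ 2 / 16 * ((N : ℝ) ^ d * (25 + 16 * Real.log N)) := by gcongr
    _ = (N : ℝ) ^ (d + 2) * (25 / 16 + Real.log N) := by ring
    _ ≤ _ := by gcongr; norm_num

section prob

variable {E : Type*} [MeasurableSpace E] {n : ℕ}

lemma var_real (μ : Measure E) [IsProbabilityMeasure μ] (hn : 0 < n) (u : E → ℝ) (hu : Measurable u)
    (hb : ∀ x, ‖u x‖ ≤ 1) :
    ∫ xs : Fin n → E, ((n : ℝ)⁻¹ * ∑ i, u (xs i) - ∫ x, u x ∂μ) ^ 2 ∂(Measure.pi fun _ => μ)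
      ≤ (n : ℝ)⁻¹ * ∫ x, (u x) ^ 2 ∂μ := by
  have hL : MemLp u 2 μ := MemLp.of_bound hu.aestronglyMeasurable 1 (Filter.Eventually.of_forall hb)
  have hn' : (n : ℝ) ≠ 0 := by positivity
  have h1 := ProbabilityTheory.variance_sum_pi (μ := fun _ : Fin n => μ) (X := fun _ => u) (fun _ => hL)
  have hmeas : Measurable (∑ i, fun ω : Fin n → E => u (ω i)) := by fun_prop
  rw [ProbabilityTheory.variance_eq_integral hmeas.aemeasurable] at h1
  have hint : ∫ ω : Fin n → E, (∑ i, fun ω : Fin n → E => u (ω i)) ω ∂(Measure.pi fun _ => μ)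
      = n * ∫ x, u x ∂μ := by
    simp only [Finset.sum_apply]
    rw [integral_finsetSum]
    · have : ∀ i : Fin n, ∫ ω : Fin n → E, u (ω i) ∂(Measure.pi fun _ => μ) = ∫ x, u x ∂μ := by
        intro i
        have hmp := measurePreserving_eval (fun _ : Fin n => μ) i
        have := integral_map (μ := Measure.pi fun _ : Fin n => μ) (φ := Function.eval i)
          hmp.measurable.aemeasurable (f := u) hu.aestronglyMeasurable
        rw [hmp.map_eq] at this
        exact this.symm
      simp [this]
    · intro i _
      exact Integrable.of_bound (Measurable.aestronglyMeasurable (by fun_prop)) 1 (Filter.Eventually.of_forall fun x => hb _)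
  rw [hint] at h1
  have h2 : ∀ xs : Fin n → E, ((n : ℝ)⁻¹ * ∑ i, u (xs i) - ∫ x, u x ∂μ) ^ 2 =
     ((n : ℝ)⁻¹) ^ 2 * ((∑ i, fun ω : Fin n → E => u (ω i)) xs - n * ∫ x, u x ∂μ) ^ 2 := by
    intro xs
    rw [← mul_pow, Finset.sum_apply]
    congr 1
    field_simp
  simp_rw [h2]
  rw [integral_const_mul, h1]
  have h3 := ProbabilityTheory.variance_le_expectation_sq (μ := μ) hu.aestronglyMeasurable
  simp only [Finset.sum_const, Finset.card_univ, Fintype.card_fin, nsmul_eq_mul]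
  calc _ = (n : ℝ)⁻¹ * ProbabilityTheory.variance u μ := by field_simp
    _ ≤ _ := by gcongr; exact h3

lemma var_complex (μ : Measure E) [IsProbabilityMeasure μ] (hn : 0 < n) (u : E → ℂ) (hu : Measurable u)
    (hb : ∀ x, ‖u x‖ = 1) :
    Integrable (fun xs : Fin n → E => ‖(n : ℂ)⁻¹ * ∑ i, u (xs i) - ∫ x, u x ∂μ‖ ^ 2)
      (Measure.pi fun _ => μ) ∧
    ∫ xs : Fin n → E, ‖(n : ℂ)⁻¹ * ∑ i, u (xs i) - ∫ x, u x ∂μ‖ ^ 2 ∂(Measure.pi fun _ => μ)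
      ≤ (n : ℝ)⁻¹ := by
  have hui : Integrable u μ :=
    Integrable.of_bound hu.aestronglyMeasurable 1 (Filter.Eventually.of_forall fun x => (hb x).le)
  have hre : ∀ x, ‖(u x).re‖ ≤ 1 := fun x => (Complex.abs_re_le_norm _).trans (hb x).le
  have him : ∀ x, ‖(u x).im‖ ≤ 1 := fun x => (Complex.abs_im_le_norm _).trans (hb x).le
  have h1 := var_real μ hn (fun x => (u x).re) (by fun_prop) hre
  have h2 := var_real μ hn (fun x => (u x).im) (by fun_prop) him
  have hbd : ∀ (v : E → ℝ), Measurable v → (∀ x, ‖v x‖ ≤ 1) → 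
      Integrable (fun xs : Fin n → E => ((n : ℝ)⁻¹ * ∑ i, v (xs i) - ∫ x, v x ∂μ) ^ 2)
      (Measure.pi fun _ => μ) := by
    intro v hv hvb
    refine Integrable.of_bound (Measurable.aestronglyMeasurable (by fun_prop)) (2 ^ 2) (Filter.Eventually.of_forall fun xs => ?_)
    rw [norm_pow]
    gcongr
    refine (norm_sub_le _ _).trans ?_
    have e1 : ‖(n : ℝ)⁻¹ * ∑ i, v (xs i)‖ ≤ 1 := by
      rw [norm_mul]
      have : ‖∑ i, v (xs i)‖ ≤ n := by
        refine (norm_sum_le _ _).trans ?_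
        refine (Finset.sum_le_sum fun i _ => hvb (xs i)).trans ?_
        simp
      rw [norm_inv, Real.norm_natCast]
      rw [inv_mul_le_iff₀ (by positivity)]; linarith
    have e2 : ‖∫ x, v x ∂μ‖ ≤ 1 := by
      have := norm_integral_le_of_norm_le_const (μ := μ) (C := 1) (Filter.Eventually.of_forall hvb)
      simpa using this
    linarith
  have hI1 := hbd _ (by fun_prop : Measurable fun x => (u x).re) hre
  have hI2 := hbd _ (by fun_prop : Measurable fun x => (u x).im) him
  have heq : (fun xs : Fin n → E => ‖(n : ℂ)⁻¹ * ∑ i, u (xs i) - ∫ x, u x ∂μ‖ ^ 2) =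
      fun xs => ((n : ℝ)⁻¹ * ∑ i, (u (xs i)).re - ∫ x, (u x).re ∂μ) ^ 2 +
        ((n : ℝ)⁻¹ * ∑ i, (u (xs i)).im - ∫ x, (u x).im ∂μ) ^ 2 := by
    funext xs
    rw [← Complex.normSq_eq_norm_sq, Complex.normSq_apply]
    have r1 : ∫ x, (u x).re ∂μ = (∫ x, u x ∂μ).re := integral_re hui
    have r2 : ∫ x, (u x).im ∂μ = (∫ x, u x ∂μ).im := integral_im hui
    rw [r1, r2]
    have c : ((n : ℂ)⁻¹) = (((n : ℝ)⁻¹ : ℝ) : ℂ) := by push_cast; rfl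
    rw [c, Complex.sub_re, Complex.sub_im, Complex.re_ofReal_mul, Complex.im_ofReal_mul,
      Complex.re_sum, Complex.im_sum]
    ring
  rw [heq]
  refine ⟨hI1.add hI2, ?_⟩
  rw [integral_add hI1 hI2]
  refine (add_le_add h1 h2).trans ?_
  rw [← mul_add, ← integral_add]
  · have : ∀ x, (u x).re ^ 2 + (u x).im ^ 2 = 1 := by
      intro x
      have := hb x
      rw [← sq_eq_sq₀ (norm_nonneg _) zero_le_one, ← Complex.normSq_eq_norm_sq, Complex.normSq_apply] at this
      linarith
    simp [this]
  · exact Integrable.of_bound (Measurable.aestronglyMeasurable (by fun_prop)) 1 (Filter.Eventually.of_forall fun x => by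
      rw [norm_pow]; exact pow_le_one₀ (norm_nonneg _) (hre x))
  · exact Integrable.of_bound (Measurable.aestronglyMeasurable (by fun_prop)) 1 (Filter.Eventually.of_forall fun x => by
      rw [norm_pow]; exact pow_le_one₀ (norm_nonneg _) (him x))

end prob

noncomputable def qz (R h : ℝ) (x : EuclideanSpace ℝ (Fin D)) : Fin D → ℤ :=
  fun j => ⌊(x j + R) / h⌋

noncomputable def q (N : ℕ) (R h : ℝ) (x : EuclideanSpace ℝ (Fin D)) : Fin D → ZMod N :=
  fun j => ((qz R h x j : ℤ) : ZMod N)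

noncomputable def pos (R h : ℝ) (a : Fin D → ZMod N) : EuclideanSpace ℝ (Fin D) :=
  WithLp.toLp 2 fun j => h * ((a j).valMinAbs.natAbs : ℝ) - R

set_option linter.unusedSectionVars false

lemma qz_meas (R h : ℝ) : Measurable (qz (D := D) R h) := by
  unfold qz
  fun_prop

lemma q_meas (R h : ℝ) {β : Type*} [MeasurableSpace β] (g : (Fin D → ZMod N) → β) :
    Measurable (fun x => g (q N R h x)) := by
  have : Measurable (fun z : Fin D → ℤ => g (fun j => (z j : ZMod N))) := measurable_of_countable _
  exact this.comp (qz_meas R h)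

lemma one_natAbs : ((1 : ZMod N).valMinAbs.natAbs) ≤ 1 := by
  rw [ZMod.valMinAbs_natAbs_eq_min]
  refine (min_le_left _ _).trans ?_
  have h := ZMod.val_natCast N 1
  rw [Nat.cast_one] at h
  rw [h]; exact Nat.mod_le _ _

lemma step (a : ZMod N) :
    |((a + 1).valMinAbs.natAbs : ℝ) - (a.valMinAbs.natAbs : ℝ)| ≤ 1 := by
  have h1 := ZMod.natAbs_valMinAbs_add_le a 1
  have h2 := ZMod.natAbs_valMinAbs_add_le (a + 1) (-1)
  have h3 : ((-1 : ZMod N).valMinAbs.natAbs) ≤ 1 := by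
    rw [ZMod.natAbs_valMinAbs_neg]; exact one_natAbs
  have h4 := one_natAbs (N := N)
  rw [add_neg_cancel_right] at h2
  have h5 : (a + 1).valMinAbs.natAbs ≤ a.valMinAbs.natAbs + 1 := by omega
  have h6 : a.valMinAbs.natAbs ≤ (a + 1).valMinAbs.natAbs + 1 := by omega
  rw [abs_sub_le_iff]
  constructor
  · have : ((a + 1).valMinAbs.natAbs : ℝ) ≤ a.valMinAbs.natAbs + 1 := by exact_mod_cast h5
    linarith
  · have : (a.valMinAbs.natAbs : ℝ) ≤ (a + 1).valMinAbs.natAbs + 1 := by exact_mod_cast h6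
    linarith

lemma pos_step (R h : ℝ) (hh : 0 < h) (a : Fin D → ZMod N) (j : Fin D) :
    dist (pos R h (a + Pi.single j 1)) (pos R h a) ≤ h := by
  rw [EuclideanSpace.dist_eq, Finset.sum_eq_single j]
  · rw [Real.sqrt_sq dist_nonneg, Real.dist_eq]
    simp only [pos, Pi.add_apply, Pi.single_eq_same]
    rw [show ∀ u v : ℝ, h * u - R - (h * v - R) = h * (u - v) by intros; ring, abs_mul, abs_of_pos hh]
    have := step (a j)
    nlinarith
  · intro i _ hij
    simp [pos, hij]
  · simp

lemma quant (M : ℕ) (hM : 0 < M) (hNM : N = 2 * M) (R h : ℝ) (hR : 0 < R) (hh : h = 2 * R / M)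
    (x : EuclideanSpace ℝ (Fin D)) (hx : ‖x‖ ≤ R) :
    dist x (pos R h (q N R h x)) ≤ √D * h := by
  have hM' : (0 : ℝ) < M := by exact_mod_cast hM
  have hpos : 0 < h := by rw [hh]; positivity
  have hc : ∀ j, dist (x j) ((pos R h (q N R h x)) j) ≤ h := by
    intro j
    have hxj : |x j| ≤ R := by
      have := PiLp.norm_apply_le x j
      rw [Real.norm_eq_abs] at this
      linarith
    obtain ⟨l1, l2⟩ := abs_le.mp hxj
    set z : ℤ := ⌊(x j + R) / h⌋ with hz
    have hz0 : 0 ≤ z := Int.floor_nonneg.mpr (div_nonneg (by linarith) hpos.le)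
    have hfl := Int.floor_le ((x j + R) / h)
    have hfl2 := Int.lt_floor_add_one ((x j + R) / h)
    rw [← hz] at hfl hfl2
    have hzM : z ≤ M := by
      have : (z : ℝ) ≤ (M : ℝ) := by
        refine hfl.trans ?_
        rw [div_le_iff₀ hpos, hh]
        field_simp
        linarith
      exact_mod_cast this
    have hv : ((z : ZMod N)).valMinAbs = z := by
      rw [ZMod.valMinAbs_spec]
      refine ⟨rfl, ?_, ?_⟩ <;> subst hNM <;> push_cast <;> omega
    have hp : (pos R h (q N R h x)) j = h * z - R := by
      simp only [pos, q, qz]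
      rw [← hz, hv, ← Int.cast_natCast, Int.natAbs_of_nonneg hz0]
    rw [hp, Real.dist_eq]
    rw [le_div_iff₀ hpos] at hfl
    rw [div_lt_iff₀ hpos] at hfl2
    rw [abs_le]; constructor <;> linarith
  rw [EuclideanSpace.dist_eq]
  calc √(∑ j, dist (x j) ((pos R h (q N R h x)) j) ^ 2) ≤ √(∑ j : Fin D, h ^ 2) := by
        apply Real.sqrt_le_sqrt
        gcongr with j _
        exact hc j
    _ = √D * h := by
        simp [Real.sqrt_sq hpos.le]

noncomputable def Zk {n : ℕ} (N : ℕ) [NeZero N] (R h : ℝ) (μ : Measure (EuclideanSpace ℝ (Fin D)))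
    (xs : Fin n → EuclideanSpace ℝ (Fin D)) (k : Fin D → ZMod N) : ℂ :=
  (n : ℂ)⁻¹ * ∑ i, chi k (q N R h (xs i)) - ∫ x, chi k (q N R h x) ∂μ

lemma disc {n : ℕ} (hn : 0 < n) (hD : 0 < D) (R h : ℝ) (hh : 0 < h) (μ : Measure (EuclideanSpace ℝ (Fin D)))
    [IsProbabilityMeasure μ]
    (xs : Fin n → EuclideanSpace ℝ (Fin D)) (F : EuclideanSpace ℝ (Fin D) → ℝ) (hF : LipschitzWith 1 F) :
    (n : ℝ)⁻¹ * ∑ i, F (pos R h (q N R h (xs i))) - ∫ x, F (pos R h (q N R h x)) ∂μ ≤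
      √D * h / 2 * (1 + ∑ k, ‖Zk N R h μ xs k‖ ^ 2 * (lam k)⁻¹) := by
  have hN : (0 : ℝ) < N := by exact_mod_cast Nat.pos_of_ne_zero (NeZero.ne N)
  have hn' : (n : ℂ) ≠ 0 := by exact_mod_cast hn.ne'
  set Φ : (Fin D → ZMod N) → ℂ := fun a => ((F (pos R h a) : ℝ) : ℂ) with hΦ
  have hZ0 : Zk N R h μ xs 0 = 0 := by
    simp [Zk, chi_zero_left, hn']
  have hk := key Φ h hh hD (by
    intro a j
    rw [hΦ]
    simp only
    rw [← Complex.ofReal_sub, Complex.norm_real, ← dist_eq_norm]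
    have := hF.dist_le_mul (pos R h (a + Pi.single j 1)) (pos R h a)
    have h2 := pos_step R h hh a j
    simp only [NNReal.coe_one, one_mul] at this
    linarith) (Zk N R h μ xs) hZ0
  have hchi : ∀ k, Integrable (fun x => chi k (q N R h x)) μ := fun k =>
    Integrable.of_bound (q_meas R h (chi k)).aestronglyMeasurable 1
      (Filter.Eventually.of_forall fun x => (chi_norm _ _).le)
  have hsum : ∑ k, hat Φ k * Zk N R h μ xs k = (N : ℂ) ^ D * 
      (((n : ℝ)⁻¹ * ∑ i, F (pos R h (q N R h (xs i))) - ∫ x, F (pos R h (q N R h x)) ∂μ : ℝ) : ℂ) := by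
    unfold Zk
    simp_rw [mul_sub, Finset.sum_sub_distrib]
    have e1 : ∑ k, hat Φ k * ((n : ℂ)⁻¹ * ∑ i, chi k (q N R h (xs i))) =
        (n : ℂ)⁻¹ * ∑ i, (N : ℂ) ^ D * Φ (q N R h (xs i)) := by
      simp_rw [← inversion, Finset.mul_sum]
      rw [Finset.sum_comm]
      refine Finset.sum_congr rfl fun i _ => Finset.sum_congr rfl fun k _ => ?_
      ring
    have e2 : ∑ k, hat Φ k * ∫ x, chi k (q N R h x) ∂μ = (N : ℂ) ^ D * ∫ x, Φ (q N R h x) ∂μ := by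
      simp_rw [← integral_const_mul]
      rw [← integral_finsetSum _ (fun k _ => (hchi k).const_mul _)]
      simp_rw [inversion]
    rw [e1, e2]
    push_cast
    rw [mul_sub, ← Finset.mul_sum, ← integral_complex_ofReal]
    ring
  rw [hsum, norm_mul, Complex.norm_real, norm_pow, Complex.norm_natCast] at hk
  have := le_of_mul_le_mul_left hk (by positivity)
  exact (le_abs_self _).trans this

lemma pointwise {n : ℕ} (hn : 0 < n) (hD : 0 < D) (M : ℕ) (hM : 0 < M) (hNM : N = 2 * M)
    (R h : ℝ) (hR : 0 < R) (hh : h = 2 * R / M)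
    (μ : Measure (EuclideanSpace ℝ (Fin D)))
    [IsProbabilityMeasure μ] (hμ : ∀ᵐ x ∂μ, ‖x‖ ≤ R)
    (xs : Fin n → EuclideanSpace ℝ (Fin D)) (hxs : ∀ i, ‖xs i‖ ≤ R)
    (F : EuclideanSpace ℝ (Fin D) → ℝ) (hF : LipschitzWith 1 F) :
    (n : ℝ)⁻¹ * ∑ i, F (xs i) - ∫ x, F x ∂μ ≤
      2 * (√D * h) + √D * h / 2 * (1 + ∑ k, ‖Zk N R h μ xs k‖ ^ 2 * (lam k)⁻¹) := by
  have hM' : (0 : ℝ) < M := by exact_mod_cast hM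
  have hpos : 0 < h := by rw [hh]; positivity
  have hn' : (0 : ℝ) < n := by exact_mod_cast hn
  have hd := disc (N := N) hn hD R h hpos μ xs F hF
  have happ : ∀ x : EuclideanSpace ℝ (Fin D), ‖x‖ ≤ R → |F x - F (pos R h (q N R h x))| ≤ √D * h := by
    intro x hx
    have h1 := quant M hM hNM R h hR hh x hx
    have h2 := hF.dist_le_mul x (pos R h (q N R h x))
    simp only [NNReal.coe_one, one_mul, Real.dist_eq] at h2
    linarith
  have hI1 : Integrable F μ := by
    refine Integrable.of_bound hF.continuous.aestronglyMeasurable (|F 0| + R) ?_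
    filter_upwards [hμ] with x hx
    have h2 := hF.dist_le_mul x 0
    simp only [NNReal.coe_one, one_mul, Real.dist_eq, dist_zero_right] at h2
    rw [Real.norm_eq_abs]
    have := abs_sub_abs_le_abs_sub (F x) (F 0)
    linarith
  have hI2 : Integrable (fun x => F (pos R h (q N R h x))) μ := by
    refine Integrable.of_bound (q_meas R h (fun a => F (pos R h a))).aestronglyMeasurable
      (|F 0| + R + √D * h) ?_
    filter_upwards [hμ] with x hx
    have h2 := hF.dist_le_mul x 0
    simp only [NNReal.coe_one, one_mul, Real.dist_eq, dist_zero_right] at h2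
    rw [Real.norm_eq_abs]
    have := abs_sub_abs_le_abs_sub (F x) (F 0)
    have h4 := abs_sub_abs_le_abs_sub (F (pos R h (q N R h x))) (F x) 
    rw [abs_sub_comm] at h4
    have := happ x hx
    linarith
  have hA : ∫ x, F (pos R h (q N R h x)) ∂μ - √D * h ≤ ∫ x, F x ∂μ := by
    have : ∫ x, (F (pos R h (q N R h x)) - √D * h) ∂μ ≤ ∫ x, F x ∂μ := by
      apply integral_mono_ae (hI2.sub (integrable_const _)) hI1
      filter_upwards [hμ] with x hx
      have := (abs_le.mp (happ x hx)).1
      change F (pos R h (q N R h x)) - √D * h ≤ F x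
      linarith
    rw [integral_sub hI2 (integrable_const _)] at this
    simpa using this
  have hB : (n : ℝ)⁻¹ * ∑ i, F (xs i) ≤ (n : ℝ)⁻¹ * ∑ i, F (pos R h (q N R h (xs i))) + √D * h := by
    have : ∑ i, F (xs i) ≤ ∑ i, (F (pos R h (q N R h (xs i))) + √D * h) := by
      refine Finset.sum_le_sum fun i _ => ?_
      have := (abs_le.mp (happ _ (hxs i))).2
      linarith
    rw [Finset.sum_add_distrib] at this
    simp only [Finset.sum_const, Finset.card_univ, Fintype.card_fin, nsmul_eq_mul] at this
    calc _ ≤ (n : ℝ)⁻¹ * (∑ i, F (pos R h (q N R h (xs i))) + n * (√D * h)) := by gcongr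
      _ = _ := by field_simp
  linarith

lemma trivial_bd {n : ℕ} (hn : 0 < n) (R : ℝ)
    (μ : Measure (EuclideanSpace ℝ (Fin D)))
    [IsProbabilityMeasure μ] (hμ : ∀ᵐ x ∂μ, ‖x‖ ≤ R)
    (xs : Fin n → EuclideanSpace ℝ (Fin D)) (hxs : ∀ i, ‖xs i‖ ≤ R)
    (F : EuclideanSpace ℝ (Fin D) → ℝ) (hF : LipschitzWith 1 F) :
    (n : ℝ)⁻¹ * ∑ i, F (xs i) - ∫ x, F x ∂μ ≤ 2 * R := by
  have hn' : (0 : ℝ) < n := by exact_mod_cast hn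
  have happ : ∀ x : EuclideanSpace ℝ (Fin D), ‖x‖ ≤ R → |F x - F 0| ≤ R := by
    intro x hx
    have h2 := hF.dist_le_mul x 0
    simp only [NNReal.coe_one, one_mul, Real.dist_eq, dist_zero_right] at h2
    linarith
  have hI1 : Integrable F μ := by
    refine Integrable.of_bound hF.continuous.aestronglyMeasurable (|F 0| + R) ?_
    filter_upwards [hμ] with x hx
    rw [Real.norm_eq_abs]
    have := abs_sub_abs_le_abs_sub (F x) (F 0)
    linarith [happ x hx]
  have hA : F 0 - R ≤ ∫ x, F x ∂μ := by
    have : ∫ x, (F 0 - R) ∂μ ≤ ∫ x, F x ∂μ := by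
      apply integral_mono_ae (integrable_const _) hI1
      filter_upwards [hμ] with x hx
      have := (abs_le.mp (happ x hx)).1
      linarith
    simpa using this
  have hB : (n : ℝ)⁻¹ * ∑ i, F (xs i) ≤ F 0 + R := by
    have : ∑ i, F (xs i) ≤ ∑ i : Fin n, (F 0 + R) := by
      refine Finset.sum_le_sum fun i _ => ?_
      have := (abs_le.mp (happ _ (hxs i))).2
      linarith
    rw [inv_mul_le_iff₀ hn']
    simpa [mul_add] using this
  linarith

lemma lam_sum' (hD : 2 ≤ D) : ∑ k : Fin D → ZMod N, (lam k)⁻¹ ≤ (N : ℝ) ^ D * (2 + Real.log N) := by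
  obtain ⟨d, rfl⟩ := Nat.exists_eq_add_of_le' hD
  exact lam_sum

lemma sup_le (n : ℕ) (R : ℝ) (B : ℝ) (μ : Measure (EuclideanSpace ℝ (Fin D)))
    [IsProbabilityMeasure μ] (hμ : ∀ᵐ x ∂μ, x ∈ Metric.closedBall (0 : EuclideanSpace ℝ (Fin D)) R)
    (H : (Fin n → EuclideanSpace ℝ (Fin D)) → ℝ) (hH0 : ∀ xs, 0 ≤ H xs)
    (hHi : Integrable H (Measure.pi fun _ : Fin n => μ))
    (hH : ∀ xs : Fin n → EuclideanSpace ℝ (Fin D), (∀ i, ‖xs i‖ ≤ R) → 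
      ∀ F : EuclideanSpace ℝ (Fin D) → ℝ, LipschitzWith 1 F →
      (n : ℝ)⁻¹ * ∑ i, F (xs i) - ∫ x, F x ∂μ ≤ H xs) :
    (∫ xs : Fin n → EuclideanSpace ℝ (Fin D),
          (⨆ f ∈ {f : EuclideanSpace ℝ (Fin D) → ℝ |
              (∀ x ∈ Metric.closedBall (0 : EuclideanSpace ℝ (Fin D)) R, |f x| ≤ B) ∧
              ∀ x ∈ Metric.closedBall (0 : EuclideanSpace ℝ (Fin D)) R,
                ∀ y ∈ Metric.closedBall (0 : EuclideanSpace ℝ (Fin D)) R, |f x - f y| ≤ dist x y},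
            ((n : ℝ)⁻¹ * ∑ i, f (xs i) - ∫ y, f y ∂μ))
        ∂(Measure.pi fun _ : Fin n => μ)) ≤ ∫ xs, H xs ∂(Measure.pi fun _ : Fin n => μ) := by
  by_cases hint : Integrable (fun xs : Fin n → EuclideanSpace ℝ (Fin D) =>
          (⨆ f ∈ {f : EuclideanSpace ℝ (Fin D) → ℝ |
              (∀ x ∈ Metric.closedBall (0 : EuclideanSpace ℝ (Fin D)) R, |f x| ≤ B) ∧
              ∀ x ∈ Metric.closedBall (0 : EuclideanSpace ℝ (Fin D)) R,
                ∀ y ∈ Metric.closedBall (0 : EuclideanSpace ℝ (Fin D)) R, |f x - f y| ≤ dist x y},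
            ((n : ℝ)⁻¹ * ∑ i, f (xs i) - ∫ y, f y ∂μ))) (Measure.pi fun _ : Fin n => μ)
  swap
  · rw [integral_undef hint]; exact integral_nonneg hH0
  apply integral_mono_ae hint hHi
  have hae : ∀ᵐ xs ∂(Measure.pi fun _ : Fin n => μ), ∀ i,
      xs i ∈ Metric.closedBall (0 : EuclideanSpace ℝ (Fin D)) R := by
    rw [ae_all_iff]
    intro i
    exact (Measure.quasiMeasurePreserving_eval (fun _ : Fin n => μ) i).ae hμ
  filter_upwards [hae] with xs hxs
  refine Real.iSup_le (fun f => Real.iSup_le (fun hf => ?_) (hH0 xs)) (hH0 xs)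
  have hL : LipschitzOnWith 1 f (Metric.closedBall (0 : EuclideanSpace ℝ (Fin D)) R) := by
    apply LipschitzOnWith.of_dist_le_mul
    intro x hx y hy
    rw [Real.dist_eq]
    simpa using hf.2 x hx y hy
  obtain ⟨F, hF, hEq⟩ := hL.extend_real
  have e1 : ∫ y, f y ∂μ = ∫ y, F y ∂μ := by
    apply integral_congr_ae
    filter_upwards [hμ] with x hx using hEq hx
  have e2 : ∑ i, f (xs i) = ∑ i, F (xs i) := Finset.sum_congr rfl fun i _ => hEq (hxs i)
  rw [e1, e2]
  exact hH xs (fun i => by simpa using hxs i) F hF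

lemma final (d n : ℕ) (hd : 1 ≤ d) (hn : 2 ≤ n) (B : ℝ)
    (bmu : Measure (EuclideanSpace ℝ (Fin (d + 1)))) [IsProbabilityMeasure bmu]
    (hsupp : ∀ᵐ x ∂bmu,
        x ∈ Metric.closedBall (0 : EuclideanSpace ℝ (Fin (d + 1)))
          (Real.sqrt 2 * Real.log n)) :
      (∫ xs : Fin n → EuclideanSpace ℝ (Fin (d + 1)),
          (⨆ f ∈ {f : EuclideanSpace ℝ (Fin (d + 1)) → ℝ |
              (∀ x ∈ Metric.closedBall (0 : EuclideanSpace ℝ (Fin (d + 1)))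
                (Real.sqrt 2 * Real.log n), |f x| ≤ B) ∧
              ∀ x ∈ Metric.closedBall (0 : EuclideanSpace ℝ (Fin (d + 1)))
                (Real.sqrt 2 * Real.log n),
                ∀ y ∈ Metric.closedBall (0 : EuclideanSpace ℝ (Fin (d + 1)))
                  (Real.sqrt 2 * Real.log n), |f x - f y| ≤ dist x y},
            ((n : ℝ)⁻¹ * ∑ i, f (xs i) - ∫ y, f y ∂bmu))
        ∂(Measure.pi fun _ : Fin n => bmu)) ≤
      72 * Real.sqrt d * (n : ℝ) ^ (-(1 : ℝ) / (d + 1)) *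
        (Real.log n) ^ ((1 : ℝ) + 1 / (d + 1)) := by
  have hn0 : (0 : ℝ) < n := by positivity
  have hnpos : 0 < n := by omega
  have hn2 : (2 : ℝ) ≤ n := by exact_mod_cast hn
  have hlog2 : Real.log 2 ≤ Real.log n := Real.log_le_log two_pos hn2
  have hl2 := Real.log_two_gt_d9
  set L := Real.log n with hL
  have hLpos : 0 < L := by linarith
  set R : ℝ := √2 * L with hR
  have hRpos : 0 < R := by positivity
  have hd1 : (1 : ℝ) ≤ d := by exact_mod_cast hd
  have hsd : 1 ≤ √(d : ℝ) := by rw [Real.one_le_sqrt]; exact hd1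
  have hs2 : √2 * √2 = (2 : ℝ) := Real.mul_self_sqrt (by norm_num)
  have hs2' : √2 ≤ (2 : ℝ) := by nlinarith [Real.sqrt_nonneg (2 : ℝ)]
  set m : ℝ := n / L with hm
  have hmpos : 0 < m := by positivity
  set r : ℝ := m ^ ((1 : ℝ) / (d + 1)) with hr
  have hrpos : 0 < r := by positivity
  have hrpow : r ^ (d + 1) = m := by
    rw [hr, ← Real.rpow_natCast, ← Real.rpow_mul hmpos.le]
    push_cast
    rw [one_div_mul_cancel (by positivity), Real.rpow_one]
  have hRHS : 72 * √(d : ℝ) * (n : ℝ) ^ (-(1 : ℝ) / (d + 1)) * L ^ ((1 : ℝ) + 1 / (d + 1)) =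
      72 * √(d : ℝ) * L * r⁻¹ := by
    rw [Real.rpow_add hLpos, Real.rpow_one, hr, hm, Real.div_rpow hn0.le hLpos.le, inv_div,
      neg_div, Real.rpow_neg hn0.le]
    field_simp
  rw [hRHS]
  have hsupp' : ∀ᵐ x ∂bmu, ‖x‖ ≤ R := by
    filter_upwards [hsupp] with x hx
    simpa using hx
  by_cases hr2 : r < 2
  · refine (sup_le n R B bmu hsupp (fun _ => 2 * R) (fun _ => by positivity) (integrable_const _)
      (fun xs hxs F hF => trivial_bd hnpos R bmu hsupp' xs hxs F hF)).trans ?_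
    simp only [integral_const, probReal_univ, one_smul]
    have h1 : 1 / 2 ≤ r⁻¹ := by
      rw [one_div]; exact inv_anti₀ hrpos hr2.le
    calc 2 * R ≤ 72 * 1 * L * (1 / 2) := by rw [hR]; nlinarith
      _ ≤ 72 * √(d : ℝ) * L * r⁻¹ := by gcongr
  push Not at hr2
  set M : ℕ := ⌊r / 2⌋₊ with hMdef
  have hM1 : 1 ≤ M := by rw [hMdef, Nat.one_le_floor_iff]; linarith
  have hM1' : (1 : ℝ) ≤ M := by exact_mod_cast hM1
  have hMle : (M : ℝ) ≤ r / 2 := Nat.floor_le (by positivity)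
  have hMge : r / 4 ≤ M := by
    have := Nat.lt_floor_add_one (r / 2)
    rw [← hMdef] at this
    linarith
  obtain ⟨N, hN⟩ : ∃ N, N = 2 * M := ⟨_, rfl⟩
  have : NeZero N := ⟨by omega⟩
  have hNr : (N : ℝ) = 2 * M := by rw [hN]; push_cast; ring
  have hND : (N : ℝ) ^ (d + 1) ≤ m := by
    rw [← hrpow]; gcongr; linarith
  have hm2n : m ≤ 2 * n := by
    rw [hm, div_le_iff₀ hLpos]; nlinarith
  have hNn : (N : ℝ) ≤ n := by
    have h2 : (2 : ℝ) ≤ N := by linarith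
    have h3 : (N : ℝ) ^ 2 ≤ (N : ℝ) ^ (d + 1) := pow_le_pow_right₀ (by linarith) (by omega)
    nlinarith
  have hlogN : Real.log N ≤ L := Real.log_le_log (by linarith) hNn
  have hlogN0 : 0 ≤ Real.log N := Real.log_nonneg (by linarith)
  obtain ⟨h, hh⟩ : ∃ h, h = 2 * R / M := ⟨_, rfl⟩
  have hhpos : 0 < h := by rw [hh]; positivity
  have hhle : h ≤ 8 * R * r⁻¹ := by
    rw [hh, div_le_iff₀ (by linarith)]
    calc 2 * R = 8 * R * r⁻¹ * (r / 4) := by field_simp; ring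
      _ ≤ _ := by gcongr
  have hv : ∀ k : Fin (d + 1) → ZMod N, _ := fun k => var_complex bmu hnpos (fun x => chi k (q N R h x))
    (q_meas R h (chi k)) (fun x => chi_norm _ _)
  have hZi : ∀ k : Fin (d + 1) → ZMod N, Integrable (fun xs : Fin n → EuclideanSpace ℝ (Fin (d + 1)) => 
      ‖Zk N R h bmu xs k‖ ^ 2 * (lam k)⁻¹) (Measure.pi fun _ : Fin n => bmu) := fun k =>
    (hv k).1.mul_const _
  have hSi := integrable_finsetSum Finset.univ (fun k _ => hZi k)
  have hSint : ∫ xs : Fin n → EuclideanSpace ℝ (Fin (d + 1)), ∑ k : Fin (d + 1) → ZMod N,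
      ‖Zk N R h bmu xs k‖ ^ 2 * (lam k)⁻¹ ∂(Measure.pi fun _ : Fin n => bmu) ≤ 4 := by
    rw [integral_finsetSum _ (fun k _ => hZi k)]
    calc _ ≤ ∑ k : Fin (d + 1) → ZMod N, (n : ℝ)⁻¹ * (lam k)⁻¹ := by
          refine Finset.sum_le_sum fun k _ => ?_
          rw [integral_mul_const]
          exact mul_le_mul_of_nonneg_right (hv k).2 (inv_nonneg.mpr (lam_nonneg k))
      _ = (n : ℝ)⁻¹ * ∑ k : Fin (d + 1) → ZMod N, (lam k)⁻¹ := by rw [Finset.mul_sum]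
      _ ≤ (n : ℝ)⁻¹ * ((N : ℝ) ^ (d + 1) * (2 + Real.log N)) := by
          gcongr; exact lam_sum' (by omega)
      _ ≤ (n : ℝ)⁻¹ * (m * (4 * L)) := by
          gcongr; linarith
      _ = 4 := by rw [hm]; field_simp
  refine (sup_le n R B bmu hsupp (fun xs => 2 * (√((d + 1 : ℕ) : ℝ) * h) + √((d + 1 : ℕ) : ℝ) * h / 2 *
      (1 + ∑ k : Fin (d + 1) → ZMod N, ‖Zk N R h bmu xs k‖ ^ 2 * (lam k)⁻¹)) ?_ ?_
      (fun xs hxs F hF => pointwise (N := N) hnpos (by omega) M hM1 hN R h hRpos hh bmu hsupp' xs hxs F hF)).trans ?_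
  · intro xs
    have : 0 ≤ ∑ k : Fin (d + 1) → ZMod N, ‖Zk N R h bmu xs k‖ ^ 2 * (lam k)⁻¹ :=
      Finset.sum_nonneg fun k _ => mul_nonneg (by positivity) (inv_nonneg.mpr (lam_nonneg k))
    positivity
  · exact (integrable_const _).add (((integrable_const _).add hSi).const_mul _)
  · have hSi2 : Integrable (fun xs : Fin n → EuclideanSpace ℝ (Fin (d + 1)) => √((d + 1 : ℕ) : ℝ) * h / 2 *
        (1 + ∑ k : Fin (d + 1) → ZMod N, ‖Zk N R h bmu xs k‖ ^ 2 * (lam k)⁻¹))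
        (Measure.pi fun _ : Fin n => bmu) := ((integrable_const _).add hSi).const_mul _
    rw [integral_add (integrable_const _) hSi2, integral_const_mul (√((d + 1 : ℕ) : ℝ) * h / 2), integral_add (integrable_const _) hSi]
    simp only [integral_const, probReal_univ, one_smul]
    have hsD : √((d + 1 : ℕ) : ℝ) ≤ √2 * √(d : ℝ) := by
      rw [← Real.sqrt_mul (by norm_num)]
      apply Real.sqrt_le_sqrt
      push_cast; linarith
    calc _ ≤ 2 * (√((d + 1 : ℕ) : ℝ) * h) + √((d + 1 : ℕ) : ℝ) * h / 2 * (1 + 4) := by gcongr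
      _ = 9 / 2 * (√((d + 1 : ℕ) : ℝ) * h) := by ring
      _ ≤ 9 / 2 * ((√2 * √(d : ℝ)) * (8 * R * r⁻¹)) := by gcongr
      _ = 36 * (√2 * √2) * √(d : ℝ) * L * r⁻¹ := by rw [hR]; ring
      _ = _ := by rw [hs2]; ring

end EmpRate

/-- for the class F¹ of 1-Lipschitz functions bounded by B on the Euclidean
ball B_2^{d+1}(√2 log n) and a probability measure supported on this ball, the expected IPM
between the empirical measure of n i.i.d. samples and the measure is at most
C₀ √d · n^{−1/(d+1)} (log n)^{1+1/(d+1)}, with C₀ not depending on d or n. -/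
theorem empirical_ipm_rate_lipschitz_ball (B : ℝ) (hB : 0 < B) :
    ∃ C₀ : ℝ, 0 < C₀ ∧ ∀ (d n : ℕ), 1 ≤ d → 2 ≤ n →
      ∀ bmu : Measure (EuclideanSpace ℝ (Fin (d + 1))), IsProbabilityMeasure bmu →
      (∀ᵐ x ∂bmu,
        x ∈ Metric.closedBall (0 : EuclideanSpace ℝ (Fin (d + 1)))
          (Real.sqrt 2 * Real.log n)) →
      (∫ xs : Fin n → EuclideanSpace ℝ (Fin (d + 1)),
          (⨆ f ∈ {f : EuclideanSpace ℝ (Fin (d + 1)) → ℝ |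
              (∀ x ∈ Metric.closedBall (0 : EuclideanSpace ℝ (Fin (d + 1)))
                (Real.sqrt 2 * Real.log n), |f x| ≤ B) ∧
              ∀ x ∈ Metric.closedBall (0 : EuclideanSpace ℝ (Fin (d + 1)))
                (Real.sqrt 2 * Real.log n),
                ∀ y ∈ Metric.closedBall (0 : EuclideanSpace ℝ (Fin (d + 1)))
                  (Real.sqrt 2 * Real.log n), |f x - f y| ≤ dist x y},
            ((n : ℝ)⁻¹ * ∑ i, f (xs i) - ∫ y, f y ∂bmu))
        ∂(Measure.pi fun _ : Fin n => bmu)) ≤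
      C₀ * Real.sqrt d * (n : ℝ) ^ (-(1 : ℝ) / (d + 1)) *
        (Real.log n) ^ ((1 : ℝ) + 1 / (d + 1)) := by
  refine ⟨72, by norm_num, ?_⟩
  intro d n hd hn bmu hbmu hsupp
  exact EmpRate.final d n hd hn B bmu hsupp
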